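/- Let (Z,ρ) be a μ-uniformly perfect K-quasi-metric space with no isolated points. Then every η-quasisymmetric bijection f from (Z,ρ) onto a K'-quasi-metric space (Z₂,ρ₂) is power quasisymmetric, i.e., f is η'-quasisymmetric with η'(t) = M·max(t^{1/α}, t^α) for constants α ≥ 1 and M ≥ 1 depending only on μ, η, K and K'. -/

import Mathlib

open Filter Topology

universe u v

/-- `ρ` is a `K`-quasi-metric on `Z`: nonnegative, vanishing exactly on the diagonal,
symmetric, and satisfying `ρ(x,z) ≤ K·max(ρ(x,y), ρ(y,z))`. -/
def IsQuasiMetric {Z : Type*} (K : ℝ) (ρ : Z → Z → ℝ) : Prop :=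
  (∀ x y : Z, 0 ≤ ρ x y) ∧ (∀ x y : Z, ρ x y = 0 ↔ x = y) ∧
    (∀ x y : Z, ρ x y = ρ y x) ∧ (∀ x y z : Z, ρ x z ≤ K * max (ρ x y) (ρ y z))

/-- `(Z,ρ)` is `μ`-uniformly perfect. -/
def UniformlyPerfectWith {Z : Type*} (ρ : Z → Z → ℝ) (μ : ℝ) : Prop :=
  ∀ x : Z, ∀ r : ℝ, 0 < r → (∃ z : Z, r ≤ ρ x z) →
    ∃ y : Z, μ * r ≤ ρ x y ∧ ρ x y < r

/-- `(Z,ρ)` is `(l₁,l₂)`-homogeneously dense. -/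
def HomogeneouslyDense {Z : Type*} (ρ : Z → Z → ℝ) (l₁ l₂ : ℝ) : Prop :=
  ∀ a b : Z, a ≠ b → ∃ x : Z, l₁ * ρ a b ≤ ρ a x ∧ ρ a x ≤ l₂ * ρ a b

/-- The cross ratio `r(a,b,c,d) = ρ(a,c)ρ(b,d)/(ρ(a,b)ρ(c,d))`. -/
noncomputable def crossRatio {Z : Type*} (ρ : Z → Z → ℝ) (a b c d : Z) : ℝ :=
  ρ a c * ρ b d / (ρ a b * ρ c d)

/-- `x : ℤ → Z` is a `σ`-chain joining `a` and `b`. -/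
def IsSigmaChain {Z : Type*} (ρ : Z → Z → ℝ) (σ : ℝ) (a b : Z) (x : ℤ → Z) : Prop :=
  (∀ i : ℤ, a ≠ x i ∧ x i ≠ b) ∧
    Filter.Tendsto (fun i : ℤ => ρ (x i) a) Filter.atBot (nhds 0) ∧
    Filter.Tendsto (fun i : ℤ => ρ (x i) b) Filter.atTop (nhds 0) ∧
    ∀ i : ℤ, |Real.log (crossRatio ρ a (x i) (x (i + 1)) b)| ≤ Real.log σ

/-- `(Z,ρ)` is `σ`-dense: any pair of distinct points is joined by a `σ`-chain. -/
def SigmaDense {Z : Type*} (ρ : Z → Z → ℝ) (σ : ℝ) : Prop :=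
  ∀ a b : Z, a ≠ b → ∃ x : ℤ → Z, IsSigmaChain ρ σ a b x

/-- `η` is an increasing self-homeomorphism of `[0,∞)`. -/
def ControlFun (η : ℝ → ℝ) : Prop :=
  η 0 = 0 ∧ StrictMonoOn η (Set.Ici 0) ∧ ContinuousOn η (Set.Ici 0) ∧
    ∀ s : ℝ, 0 ≤ s → ∃ t : ℝ, 0 ≤ t ∧ η t = s

/-- `f` is `η`-quasisymmetric. -/
def QuasiSymmetric {Z₁ Z₂ : Type*} (ρ₁ : Z₁ → Z₁ → ℝ) (ρ₂ : Z₂ → Z₂ → ℝ)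
    (f : Z₁ → Z₂) (η : ℝ → ℝ) : Prop :=
  ∀ x a b : Z₁, x ≠ b → ∀ t : ℝ, 0 ≤ t → ρ₁ x a ≤ t * ρ₁ x b →
    ρ₂ (f x) (f a) ≤ η t * ρ₂ (f x) (f b)

/-- `f` is `θ`-quasimöbius. -/
def QuasiMobius {Z₁ Z₂ : Type*} (ρ₁ : Z₁ → Z₁ → ℝ) (ρ₂ : Z₂ → Z₂ → ℝ)
    (f : Z₁ → Z₂) (θ : ℝ → ℝ) : Prop :=
  ∀ a b c d : Z₁, a ≠ b → a ≠ c → a ≠ d → b ≠ c → b ≠ d → c ≠ d →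
    crossRatio ρ₂ (f a) (f b) (f c) (f d) ≤ θ (crossRatio ρ₁ a b c d)

/-- `(Z,ρ)` has no isolated points. -/
def NoIsolatedPoints {Z : Type*} (ρ : Z → Z → ℝ) : Prop :=
  ∀ x : Z, ∀ r : ℝ, 0 < r → ∃ y : Z, y ≠ x ∧ ρ x y < r

/-- Uniform perfectness provides a point at distance comparable to `δ * ρ x a`. -/
theorem UniformlyPerfectWith.exists_near_scale {Z : Type*} {ρ : Z → Z → ℝ} {μ δ : ℝ}
    (hup : UniformlyPerfectWith ρ μ) (hδ0 : 0 < δ) (hδ1 : δ ≤ 1) {x a : Z} (ha : 0 < ρ x a) :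
    ∃ y : Z, μ * (δ * ρ x a) ≤ ρ x y ∧ ρ x y < δ * ρ x a :=
  hup x (δ * ρ x a) (by positivity) ⟨a, mul_le_of_le_one_left ha.le hδ1⟩

section Iteration

variable {Z Z₂ : Type*} {K K' μ : ℝ} {ρ : Z → Z → ℝ} {ρ₂ : Z₂ → Z₂ → ℝ} {f : Z → Z₂}
  {η : ℝ → ℝ}

theorem IsQuasiMetric.pos (hρ : IsQuasiMetric K ρ) {x y : Z} (h : x ≠ y) : 0 < ρ x y :=
  lt_of_le_of_ne (hρ.1 x y) fun h0 => h ((hρ.2.1 x y).1 h0.symm)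

theorem IsQuasiMetric.ne_of_pos (hρ : IsQuasiMetric K ρ) {x y : Z} (h : 0 < ρ x y) : x ≠ y :=
  fun he => h.ne' ((hρ.2.1 x y).2 he)

/-- Iterated growth estimate: ratios at most `μ⁻¹ ^ n` are distorted by at most `C ^ (n + 1)`. -/
theorem QuasiSymmetric.le_pow_of_le_inv_pow (hqs : QuasiSymmetric ρ ρ₂ f η)
    (hρ : IsQuasiMetric K ρ) (hρ₂ : IsQuasiMetric K' ρ₂) (hup : UniformlyPerfectWith ρ μ)
    (hμ0 : 0 < μ) (hμ1 : μ < 1) {C : ℝ} (hC1 : 1 ≤ C) (hη1 : η 1 ≤ C)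
    (hημ : η (μ⁻¹ ^ 2) ≤ C) {x b : Z} (hxb : x ≠ b) (n : ℕ) (a : Z)
    (h : ρ x a ≤ μ⁻¹ ^ n * ρ x b) :
    ρ₂ (f x) (f a) ≤ C ^ (n + 1) * ρ₂ (f x) (f b) := by
  induction n generalizing a with
  | zero =>
    have h1 := hqs x a b hxb 1 zero_le_one (by simpa using h)
    simpa using h1.trans (mul_le_mul_of_nonneg_right hη1 (hρ₂.1 _ _))
  | succ n ih =>
    rcases (hρ.1 x a).eq_or_lt with h0 | h0
    · have hxa : x = a := (hρ.2.1 x a).1 h0.symm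
      subst hxa
      rw [(hρ₂.2.1 (f x) (f x)).2 rfl]
      have := hρ₂.1 (f x) (f b)
      positivity
    · obtain ⟨y, hy1, hy2⟩ := hup.exists_near_scale hμ0 hμ1.le h0
      have hxy : x ≠ y := hρ.ne_of_pos (lt_of_lt_of_le (by positivity) hy1)
      have hyb : ρ x y ≤ μ⁻¹ ^ n * ρ x b := by
        refine hy2.le.trans ((mul_le_mul_of_nonneg_left h hμ0.le).trans_eq ?_)
        rw [pow_succ]
        field_simp
      have hay : ρ x a ≤ μ⁻¹ ^ 2 * ρ x y := by
        calc ρ x a = μ⁻¹ ^ 2 * (μ * (μ * ρ x a)) := by field_simp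
          _ ≤ μ⁻¹ ^ 2 * ρ x y := by gcongr
      calc ρ₂ (f x) (f a) ≤ η (μ⁻¹ ^ 2) * ρ₂ (f x) (f y) :=
            hqs x a y hxy _ (by positivity) hay
        _ ≤ C * ρ₂ (f x) (f y) := mul_le_mul_of_nonneg_right hημ (hρ₂.1 _ _)
        _ ≤ C * (C ^ (n + 1) * ρ₂ (f x) (f b)) := by gcongr; exact ih y hyb
        _ = C ^ (n + 1 + 1) * ρ₂ (f x) (f b) := by ring

/-- Iterated decay estimate: if `η δ ≤ 1 / 2`, ratios at most `(μ * δ) ^ n` are contracted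
to at most `C * (1 / 2) ^ n`. -/
theorem QuasiSymmetric.le_half_pow_of_le_pow (hqs : QuasiSymmetric ρ ρ₂ f η)
    (hρ : IsQuasiMetric K ρ) (hρ₂ : IsQuasiMetric K' ρ₂) (hup : UniformlyPerfectWith ρ μ)
    (hμ0 : 0 < μ) {C δ : ℝ} (hη1 : η 1 ≤ C) (hC0 : 0 ≤ C)
    (hδ0 : 0 < δ) (hδ1 : δ ≤ 1) (hηδ : η δ ≤ 1 / 2) {x a : Z} (n : ℕ) (b : Z) (hxb : x ≠ b)
    (h : ρ x a ≤ (μ * δ) ^ n * ρ x b) :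
    ρ₂ (f x) (f a) ≤ C * (1 / 2) ^ n * ρ₂ (f x) (f b) := by
  induction n generalizing b with
  | zero =>
    have h1 := hqs x a b hxb 1 zero_le_one (by simpa using h)
    simpa using h1.trans (mul_le_mul_of_nonneg_right hη1 (hρ₂.1 _ _))
  | succ n ih =>
    have hb := hρ.pos hxb
    obtain ⟨y, hy1, hy2⟩ := hup.exists_near_scale hδ0 hδ1 hb
    have hxy : x ≠ y := hρ.ne_of_pos (lt_of_lt_of_le (by positivity) hy1)
    have hay : ρ x a ≤ (μ * δ) ^ n * ρ x y := by
      calc ρ x a ≤ (μ * δ) ^ n * (μ * (δ * ρ x b)) := h.trans_eq (by ring)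
        _ ≤ (μ * δ) ^ n * ρ x y := by gcongr
    have hyb : ρ₂ (f x) (f y) ≤ 1 / 2 * ρ₂ (f x) (f b) :=
      (hqs x y b hxb δ hδ0.le hy2.le).trans (mul_le_mul_of_nonneg_right hηδ (hρ₂.1 _ _))
    calc ρ₂ (f x) (f a) ≤ C * (1 / 2) ^ n * ρ₂ (f x) (f y) := ih y hxy hay
      _ ≤ C * (1 / 2) ^ n * (1 / 2 * ρ₂ (f x) (f b)) := by gcongr
      _ = C * (1 / 2) ^ (n + 1) * ρ₂ (f x) (f b) := by ring

end Iteration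

theorem ControlFun.exists_le_half {η : ℝ → ℝ} (hη : ControlFun η) :
    ∃ δ : ℝ, 0 < δ ∧ δ ≤ 1 ∧ η δ ≤ 1 / 2 := by
  obtain ⟨h0, hmono, -, hsurj⟩ := hη
  obtain ⟨t, ht0, ht⟩ := hsurj (1 / 2) (by norm_num)
  have htpos : 0 < t := ht0.lt_of_ne fun h => by
    rw [← h, h0] at ht
    norm_num at ht
  refine ⟨min t 1, by positivity, min_le_right _ _, ht ▸ ?_⟩
  exact hmono.monotoneOn (Set.mem_Ici.2 (by positivity)) ht0 (min_le_left _ _)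

theorem pow_le_rpow_of_logb_le {c β α t : ℝ} (hc : 1 ≤ c) (hβ : 1 < β) {n : ℕ}
    (ht : β ^ n ≤ t) (hα : Real.logb β c ≤ α) : c ^ n ≤ t ^ α := by
  have hβ0 : 0 < β := one_pos.trans hβ
  have hγ : 0 ≤ Real.logb β c := Real.logb_nonneg hβ hc
  calc c ^ n = (β ^ Real.logb β c) ^ n := by
        rw [Real.rpow_logb hβ0 hβ.ne' (one_pos.trans_le hc)]
    _ = (β ^ n) ^ Real.logb β c := (Real.rpow_pow_comm hβ0.le _ _)
    _ ≤ t ^ Real.logb β c := by gcongr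
    _ ≤ t ^ α := Real.rpow_le_rpow_of_exponent_le ((one_le_pow₀ hβ.le).trans ht) hα

theorem half_pow_le_rpow_of_le {q s t : ℝ} (hq0 : 0 < q) (hq1 : q < 1) {n : ℕ}
    (ht : q ^ n ≤ t) (ht1 : t ≤ 1) (hs0 : 0 < s) (hs : s ≤ Real.logb q (1 / 2)) :
    (1 / 2 : ℝ) ^ n ≤ t ^ s := by
  have hγ : 0 < Real.logb q (1 / 2) := hs0.trans_le hs
  calc (1 / 2 : ℝ) ^ n = (q ^ Real.logb q (1 / 2)) ^ n := by
        rw [Real.rpow_logb hq0 hq1.ne (by norm_num)]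
    _ = (q ^ n) ^ Real.logb q (1 / 2) := (Real.rpow_pow_comm hq0.le _ _)
    _ ≤ t ^ Real.logb q (1 / 2) := by gcongr
    _ ≤ t ^ s := Real.rpow_le_rpow_of_exponent_ge ((pow_pos hq0 n).trans_le ht) ht1 hs

/-- on a uniformly perfect quasi-metric space with no isolated points,
every quasisymmetric bijection is power quasisymmetric, quantitatively. -/
theorem stmt7 (K K' μ : ℝ) (η : ℝ → ℝ) (hK : 1 ≤ K) (hK' : 1 ≤ K')
    (hμ0 : 0 < μ) (hμ1 : μ < 1) (hη : ControlFun η) :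
    ∃ α M : ℝ, 1 ≤ α ∧ 1 ≤ M ∧
      ∀ {Z : Type u} {Z₂ : Type v} (ρ : Z → Z → ℝ) (ρ₂ : Z₂ → Z₂ → ℝ) (f : Z → Z₂),
        IsQuasiMetric K ρ → IsQuasiMetric K' ρ₂ → UniformlyPerfectWith ρ μ →
        NoIsolatedPoints ρ → Function.Bijective f → QuasiSymmetric ρ ρ₂ f η →
        QuasiSymmetric ρ ρ₂ f (fun t => M * max (t ^ (1 / α)) (t ^ α)) := by
  obtain ⟨δ, hδ0, hδ1, hηδ⟩ := hη.exists_le_half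
  obtain ⟨C, hC1, hη1, hημ⟩ : ∃ C : ℝ, 1 ≤ C ∧ η 1 ≤ C ∧ η (μ⁻¹ ^ 2) ≤ C :=
    ⟨max 1 (max (η 1) (η (μ⁻¹ ^ 2))), by simp⟩
  have hq0 : 0 < μ * δ := mul_pos hμ0 hδ0
  have hq1 : μ * δ < 1 := (mul_le_of_le_one_right hμ0.le hδ1).trans_lt hμ1
  have hμinv : 1 < μ⁻¹ := (one_lt_inv₀ hμ0).2 hμ1
  set γ : ℝ := Real.logb (μ * δ) (1 / 2)
  have hγ : 0 < γ := Real.logb_pos_of_base_lt_one hq0 hq1 (by norm_num) (by norm_num)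
  obtain ⟨α, hα1, hαC, hαγ⟩ : ∃ α : ℝ, 1 ≤ α ∧ Real.logb μ⁻¹ C ≤ α ∧ 1 / γ ≤ α :=
    ⟨max 1 (max (Real.logb μ⁻¹ C) (1 / γ)), by simp⟩
  have hα0 : 0 < α := one_pos.trans_le hα1
  refine ⟨α, 2 * C ^ 2, hα1, by nlinarith, ?_⟩
  intro Z Z₂ ρ ρ₂ f hρ hρ₂ hup _ _ hqs x a b hxb t ht0 hab
  have hb := hρ.pos hxb
  have hv := hρ₂.1 (f x) (f b)
  dsimp only
  rcases ht0.eq_or_lt with rfl | htpos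
  · have hxa : x = a := (hρ.2.1 x a).1 (le_antisymm (by simpa using hab) (hρ.1 x a))
    subst hxa
    rw [(hρ₂.2.1 (f x) (f x)).2 rfl]
    positivity
  rcases le_total 1 t with ht1 | ht1
  · obtain ⟨n, hn, hn'⟩ := exists_nat_pow_near ht1 hμinv
    calc ρ₂ (f x) (f a) ≤ C ^ (n + 1 + 1) * ρ₂ (f x) (f b) :=
          hqs.le_pow_of_le_inv_pow hρ hρ₂ hup hμ0 hμ1 hC1 hη1 hημ hxb (n + 1) a
            (hab.trans (by gcongr))
      _ = C ^ 2 * C ^ n * ρ₂ (f x) (f b) := by ring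
      _ ≤ 2 * C ^ 2 * max (t ^ (1 / α)) (t ^ α) * ρ₂ (f x) (f b) := by
        gcongr
        · nlinarith
        · exact (pow_le_rpow_of_logb_le hC1 hμinv hn hαC).trans (le_max_right _ _)
  · obtain ⟨n, hn, hn'⟩ := exists_nat_pow_near_of_lt_one htpos ht1 hq0 hq1
    calc ρ₂ (f x) (f a) ≤ C * (1 / 2) ^ n * ρ₂ (f x) (f b) :=
          hqs.le_half_pow_of_le_pow hρ hρ₂ hup hμ0 hη1 (by linarith) hδ0 hδ1 hηδ n b hxb
            (hab.trans (by gcongr))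
      _ = 2 * C * (1 / 2) ^ (n + 1) * ρ₂ (f x) (f b) := by ring
      _ ≤ 2 * C ^ 2 * max (t ^ (1 / α)) (t ^ α) * ρ₂ (f x) (f b) := by
        gcongr
        · nlinarith
        · exact (half_pow_le_rpow_of_le hq0 hq1 hn.le ht1 (by positivity)
            (by rwa [one_div_le hα0 hγ])).trans (le_max_left _ _)
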